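/- Assume k ≥ 1 and that two designated variables X_a and X_b among X_1,…,X_d satisfy the noisy-copy condition with parameter λ > 0. Let α := H(X_a ∣ S₀), where S₀ is the set of all variables other than X_a and X_b, and assume λ < α. Let F = {f_a, f_b} be a legal family set for {X_a, X_b} whose score is maximal among all legal family sets for {X_a, X_b}. Then in F, either X_b is a parent of X_a or X_a is a parent of X_b. -/

import Mathlib

open Finset

/-- Shannon entropy (in nats) of a discrete random variable `X` on a finite
probability space with probability mass function `μ`. -/
noncomputable def ent {Ω γ : Type*} [Fintype Ω] [Fintype γ] [DecidableEq γ]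
    (μ : Ω → ℝ) (X : Ω → γ) : ℝ :=
  ∑ x : γ, Real.negMulLog (∑ ω : Ω, if X ω = x then μ ω else 0)

/-- Conditional Shannon entropy H(X ∣ Y), via the chain rule `H(X ∣ Y) = H(X,Y) - H(Y)`. -/
noncomputable def condEnt {Ω γ δ : Type*} [Fintype Ω] [Fintype γ] [Fintype δ]
    [DecidableEq γ] [DecidableEq δ] (μ : Ω → ℝ) (X : Ω → γ) (Y : Ω → δ) : ℝ :=
  ent μ (fun ω => (X ω, Y ω)) - ent μ Y

/-- `μ` is a probability mass function on the finite sample space `Ω`. -/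
def IsPMF {Ω : Type*} [Fintype Ω] (μ : Ω → ℝ) : Prop :=
  (∀ ω, 0 ≤ μ ω) ∧ ∑ ω : Ω, μ ω = 1

/-- The joint value of the tuple of variables `X j` for `j` in the finite set `P`. -/
def tupleOf {d : ℕ} {Ω α : Type*} (X : Fin d → Ω → α) (P : Finset (Fin d)) :
    Ω → ({j // j ∈ P} → α) :=
  fun ω j => X j.1 ω

/-- The entropy H(f) of the family `f = ⟨X_i, P⟩`: the conditional Shannon entropy of the
child variable `X i` given the joint value of its parents, the variables `X j` for `j ∈ P`. -/
noncomputable def famEnt {d : ℕ} {Ω α : Type*} [Fintype Ω] [Fintype α] [DecidableEq α]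
    (μ : Ω → ℝ) (X : Fin d → Ω → α) (i : Fin d) (P : Finset (Fin d)) : ℝ :=
  condEnt μ (X i) (tupleOf X P)

/-- A relation is acyclic if no (nonempty) directed path leads from a vertex to itself. -/
def Acyclic {V : Type*} (r : V → V → Prop) : Prop :=
  ∀ v, ¬ Relation.TransGen r v v

/-- A graph over the `d` variables, given as the assignment `g` of a parent set to each
child variable, is in `𝒢_{d,k}`: no variable is its own parent, every variable has at
most `k` parents, and the parent → child edge relation is acyclic. -/
def IsDAGdk {d : ℕ} (k : ℕ) (g : Fin d → Finset (Fin d)) : Prop :=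
  (∀ i, i ∉ g i ∧ (g i).card ≤ k) ∧ Acyclic (fun u w => u ∈ g w)

/-- The score of the graph `g`: minus the sum of the entropies of its families. -/
noncomputable def score {d : ℕ} {Ω α : Type*} [Fintype Ω] [Fintype α] [DecidableEq α]
    (μ : Ω → ℝ) (X : Fin d → Ω → α) (g : Fin d → Finset (Fin d)) : ℝ :=
  -∑ i : Fin d, famEnt μ X i (g i)

/-- `S* := max_{G ∈ 𝒢_{d,k}} score(G)`, the optimal score. -/
noncomputable def Sstar {d : ℕ} {Ω α : Type*} [Fintype Ω] [Fintype α] [DecidableEq α]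
    (k : ℕ) (μ : Ω → ℝ) (X : Fin d → Ω → α) : ℝ :=
  sSup {s | ∃ g, IsDAGdk k g ∧ score μ X g = s}

/-- `g` restricted to the variables of `W` is a DAG over the variables of `W` with
in-degree at most `k` (all parents of variables of `W` are themselves in `W`). -/
def IsDAGon {d : ℕ} (k : ℕ) (W : Finset (Fin d)) (g : Fin d → Finset (Fin d)) : Prop :=
  (∀ i ∈ W, i ∉ g i ∧ (g i).card ≤ k ∧ g i ⊆ W) ∧
  Acyclic (fun u w => w ∈ W ∧ u ∈ g w)

/-- `g` restricted to `W` is a legal family set for `W`: one family (with at most `k`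
parents, drawn from all the variables) for each variable of `W`, with no directed cycle. -/
def LegalFamSet {d : ℕ} (k : ℕ) (W : Finset (Fin d)) (g : Fin d → Finset (Fin d)) : Prop :=
  (∀ i ∈ W, i ∉ g i ∧ (g i).card ≤ k) ∧ Acyclic (fun u w => w ∈ W ∧ u ∈ g w)

/-- The score of the set of families of the variables of `W` in `g`. -/
noncomputable def scoreOn {d : ℕ} {Ω α : Type*} [Fintype Ω] [Fintype α] [DecidableEq α]
    (μ : Ω → ℝ) (X : Fin d → Ω → α) (W : Finset (Fin d)) (g : Fin d → Finset (Fin d)) : ℝ :=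
  -∑ i ∈ W, famEnt μ X i (g i)

/-- The maximal score over DAGs with in-degree at most `k` over the variables of `W`. -/
noncomputable def SstarOn {d : ℕ} {Ω α : Type*} [Fintype Ω] [Fintype α] [DecidableEq α]
    (k : ℕ) (W : Finset (Fin d)) (μ : Ω → ℝ) (X : Fin d → Ω → α) : ℝ :=
  sSup {s | ∃ g, IsDAGon k W g ∧ scoreOn μ X W g = s}

/-- `X b` is a noisy copy of `X a` with parameter `lam`: `X b` is conditionally
independent of every subset `S` of the remaining variables given `X a` (expressed by
`H(X_b ∣ X_a, S) = H(X_b ∣ X_a)`), and `max(H(X_b ∣ X_a), H(X_a ∣ X_b)) ≤ lam`. -/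
def NoisyCopy {d : ℕ} {Ω α : Type*} [Fintype Ω] [Fintype α] [DecidableEq α]
    (μ : Ω → ℝ) (X : Fin d → Ω → α) (a b : Fin d) (lam : ℝ) : Prop :=
  (∀ S : Finset (Fin d), a ∉ S → b ∉ S →
      condEnt μ (X b) (fun ω => (X a ω, tupleOf X S ω)) = condEnt μ (X b) (X a)) ∧
  condEnt μ (X b) (X a) ≤ lam ∧ condEnt μ (X a) (X b) ≤ lam

/-- Probability that `U` equals `u`. -/
noncomputable def prob {Ω γ : Type*} [Fintype Ω] [DecidableEq γ]
    (μ : Ω → ℝ) (U : Ω → γ) (u : γ) : ℝ := ∑ ω : Ω, if U ω = u then μ ω else 0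

lemma prob_nonneg {Ω γ : Type*} [Fintype Ω] [DecidableEq γ]
    {μ : Ω → ℝ} (hμ : ∀ ω, 0 ≤ μ ω) (U : Ω → γ) (u : γ) : 0 ≤ prob μ U u :=
  Finset.sum_nonneg fun ω _ => by split_ifs <;> simp [hμ]

lemma le_prob {Ω γ : Type*} [Fintype Ω] [DecidableEq γ]
    {μ : Ω → ℝ} (hμ : ∀ ω, 0 ≤ μ ω) (U : Ω → γ) (ω : Ω) : μ ω ≤ prob μ U (U ω) := by
  have h := Finset.single_le_sum (f := fun ω' => if U ω' = U ω then μ ω' else 0)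
    (fun ω' _ => by split_ifs <;> simp [hμ]) (Finset.mem_univ ω)
  simpa [prob] using h

lemma sum_prob_mul {Ω γ : Type*} [Fintype Ω] [Fintype γ] [DecidableEq γ]
    (μ : Ω → ℝ) (U : Ω → γ) (f : γ → ℝ) :
    ∑ u, prob μ U u * f u = ∑ ω, μ ω * f (U ω) := by
  simp only [prob, Finset.sum_mul]
  rw [Finset.sum_comm]
  refine Finset.sum_congr rfl fun ω _ => ?_
  simp [ite_mul]

lemma ent_eq {Ω γ : Type*} [Fintype Ω] [Fintype γ] [DecidableEq γ]
    (μ : Ω → ℝ) (U : Ω → γ) :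
    ent μ U = -∑ ω, μ ω * Real.log (prob μ U (U ω)) := by
  rw [← sum_prob_mul μ U (fun u => Real.log (prob μ U u)), ← Finset.sum_neg_distrib]
  refine Finset.sum_congr rfl fun u _ => ?_
  simp [Real.negMulLog, prob]

lemma ent_congr {Ω γ δ : Type*} [Fintype Ω] [Fintype γ] [DecidableEq γ] [Fintype δ]
    [DecidableEq δ] (μ : Ω → ℝ) (U : Ω → γ) (V : Ω → δ)
    (h : ∀ ω ω', U ω' = U ω ↔ V ω' = V ω) : ent μ U = ent μ V := by
  rw [ent_eq, ent_eq]
  simp only [prob, h]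

lemma sum_prob_pair {Ω γ δ : Type*} [Fintype Ω] [Fintype γ] [DecidableEq γ]
    [DecidableEq δ] (μ : Ω → ℝ) (X : Ω → γ) (Z : Ω → δ) (z : δ) :
    ∑ x, prob μ (fun ω => (X ω, Z ω)) (x, z) = prob μ Z z := by
  simp only [prob, Prod.mk.injEq]
  rw [Finset.sum_comm]
  refine Finset.sum_congr rfl fun ω _ => ?_
  by_cases hz : Z ω = z <;> simp [hz]

/-- Conditioning on more reduces entropy. -/
lemma condEnt_le {Ω γ δ ε : Type*} [Fintype Ω] [Fintype γ] [DecidableEq γ] [Fintype δ]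
    [DecidableEq δ] [Fintype ε] [DecidableEq ε] (μ : Ω → ℝ) (hμ : IsPMF μ)
    (X : Ω → γ) (Y : Ω → δ) (g : δ → ε) :
    condEnt μ X Y ≤ condEnt μ X (fun ω => g (Y ω)) := by
  obtain ⟨h0, h1⟩ := hμ
  set Z : Ω → ε := fun ω => g (Y ω) with hZ
  set pXY := prob μ (fun ω => (X ω, Y ω)) with hpXY
  set pXZ := prob μ (fun ω => (X ω, Z ω)) with hpXZ
  set pY := prob μ Y with hpY
  set pZ := prob μ Z with hpZ
  let f : γ × δ → ℝ := fun q => pY q.2 * pXZ (q.1, g q.2) / (pXY q * pZ (g q.2))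
  have key : ∑ ω, μ ω * f (X ω, Y ω) ≤ 1 := by
    rw [← sum_prob_mul μ (fun ω => (X ω, Y ω)) f, Fintype.sum_prod_type, Finset.sum_comm]
    have hs : ∑ y, pY y = 1 := by
      have := sum_prob_mul μ Y (fun _ => 1)
      simpa [h1] using this
    rw [← hs]
    refine Finset.sum_le_sum fun y _ => ?_
    have hy : 0 ≤ pY y := prob_nonneg h0 _ _
    have hz : 0 ≤ pZ (g y) := prob_nonneg h0 _ _
    calc ∑ x, prob μ (fun ω => (X ω, Y ω)) (x, y) * f (x, y)
        ≤ ∑ x, pY y / pZ (g y) * pXZ (x, g y) := by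
          refine Finset.sum_le_sum fun x _ => ?_
          have hxz : 0 ≤ pXZ (x, g y) := prob_nonneg h0 _ _
          change pXY (x, y) * (pY y * pXZ (x, g y) / (pXY (x, y) * pZ (g y))) ≤ _
          by_cases hc : pXY (x, y) = 0
          · rw [hc, zero_mul]; positivity
          · apply le_of_eq
            rw [mul_div_assoc', mul_div_mul_left _ _ hc]; ring
      _ = pY y / pZ (g y) * pZ (g y) := by
          rw [← Finset.mul_sum, hpXZ, sum_prob_pair]
      _ ≤ pY y := by
          by_cases hc : pZ (g y) = 0
          · rw [hc]; simpa using hy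
          · rw [div_mul_cancel₀ _ hc]
  have pt : ∀ ω, μ ω * (Real.log (pY (Y ω)) + Real.log (pXZ (X ω, Z ω))
      - Real.log (pXY (X ω, Y ω)) - Real.log (pZ (Z ω))) ≤ μ ω * f (X ω, Y ω) - μ ω := by
    intro ω
    rcases (h0 ω).eq_or_lt with h | h
    · simp [← h]
    · have a1 : 0 < pY (Y ω) := h.trans_le (le_prob h0 Y ω)
      have a2 : 0 < pXZ (X ω, Z ω) := h.trans_le (le_prob h0 (fun ω => (X ω, Z ω)) ω)
      have a3 : 0 < pXY (X ω, Y ω) := h.trans_le (le_prob h0 (fun ω => (X ω, Y ω)) ω)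
      have a4 : 0 < pZ (Z ω) := h.trans_le (le_prob h0 Z ω)
      have e : f (X ω, Y ω) = pY (Y ω) * pXZ (X ω, Z ω) / (pXY (X ω, Y ω) * pZ (Z ω)) := rfl
      have l := Real.log_le_sub_one_of_pos (x := f (X ω, Y ω)) (by rw [e]; positivity)
      have l2 : Real.log (f (X ω, Y ω)) = Real.log (pY (Y ω)) + Real.log (pXZ (X ω, Z ω))
          - Real.log (pXY (X ω, Y ω)) - Real.log (pZ (Z ω)) := by
        rw [e, Real.log_div (by positivity) (by positivity),
          Real.log_mul a1.ne' a2.ne', Real.log_mul a3.ne' a4.ne']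
        ring
      rw [← l2]
      nlinarith
  have hsum := Finset.sum_le_sum fun ω (_ : ω ∈ Finset.univ) => pt ω
  rw [Finset.sum_sub_distrib, h1] at hsum
  simp only [mul_sub, mul_add, Finset.sum_sub_distrib, Finset.sum_add_distrib] at hsum
  simp only [condEnt, ent_eq]
  linarith

theorem optimal_family_pair_related
    {d k : ℕ} {Ω α : Type*} [Fintype Ω] [Fintype α] [DecidableEq α]
    (hd : 1 ≤ d) (hk : 1 ≤ k)
    (μ : Ω → ℝ) (hμ : IsPMF μ) (X : Fin d → Ω → α)
    (lam : ℝ) (hlam : 0 < lam) (a b : Fin d) (hab : a ≠ b)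
    (hnc : NoisyCopy μ X a b lam)
    (hla : lam < famEnt μ X a (Finset.univ \ {a, b}))
    (F : Fin d → Finset (Fin d)) (hF : LegalFamSet k {a, b} F)
    (hmax : ∀ F', LegalFamSet k {a, b} F' →
      scoreOn μ X {a, b} F' ≤ scoreOn μ X {a, b} F) :
    b ∈ F a ∨ a ∈ F b := by
  by_contra hcon
  push Not at hcon
  obtain ⟨hba, hab'⟩ := hcon
  obtain ⟨hci, hl1, hl2⟩ := hnc
  have haa : a ∉ F a := (hF.1 a (by simp)).1
  have hbb : b ∉ F b := (hF.1 b (by simp)).1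
  have hleg : LegalFamSet k {a, b} (Function.update F b {a}) := by
    refine ⟨fun i hi => ?_, fun v hv => ?_⟩
    · by_cases h : i = b
      · subst h; simp [hab.symm, hk]
      · rw [Function.update_of_ne h]; exact hF.1 i hi
    · -- a vertex with an incoming edge from an element of the pair is `b`
      have edge : ∀ u w, (w ∈ ({a, b} : Finset (Fin d)) ∧ u ∈ Function.update F b {a} w) →
          (w = b ∧ u = a) ∨ (w = a ∧ u ≠ a ∧ u ≠ b) := by
        rintro u w ⟨hw, hu⟩
        by_cases h : w = b
        · subst h; simp at hu; exact Or.inl ⟨rfl, hu⟩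
        · rw [Function.update_of_ne h] at hu
          simp [h] at hw
          subst hw
          exact Or.inr ⟨rfl, fun h => haa (h ▸ hu), fun h => hba (h ▸ hu)⟩
      let rk : Fin d → ℕ := fun v => if v = b then 2 else if v = a then 1 else 0
      have mono : ∀ u w, Relation.TransGen (fun u w => w ∈ ({a, b} : Finset (Fin d)) ∧
          u ∈ Function.update F b {a} w) u w → rk u < rk w := by
        have one : ∀ u w, (w ∈ ({a, b} : Finset (Fin d)) ∧ u ∈ Function.update F b {a} w) →
            rk u < rk w := by
          intro u w h
          rcases edge u w h with ⟨rfl, rfl⟩ | ⟨rfl, h1, h2⟩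
          · simp [rk, hab]
          · simp [rk, hab, h1, h2]
        intro u w h
        induction h with
        | single h => exact one _ _ h
        | tail _ h ih => exact ih.trans (one _ _ h)
      exact lt_irrefl _ (mono v v hv)
  have hm := hmax _ hleg
  simp only [scoreOn, Finset.sum_pair hab, Function.update_self,
    Function.update_of_ne hab] at hm
  set S : Finset (Fin d) := Finset.univ \ {a, b} with hS
  have haS : a ∉ S := by simp [hS]
  have hbS : b ∉ S := by simp [hS]
  have i1 : famEnt μ X b {a} ≤ condEnt μ (X b) (X a) :=
    condEnt_le μ hμ (X b) (tupleOf X {a}) (fun t => t ⟨a, by simp⟩)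
  have hsub : ∀ j, j ∈ F b → j ∈ S := by
    intro j hj
    simp only [hS, Finset.mem_sdiff, Finset.mem_univ, true_and, Finset.mem_insert,
      Finset.mem_singleton, not_or]
    exact ⟨fun h => hab' (h ▸ hj), fun h => hbb (h ▸ hj)⟩
  have i2 : famEnt μ X b S ≤ famEnt μ X b (F b) :=
    condEnt_le μ hμ (X b) (tupleOf X S) (fun t (j : {j // j ∈ F b}) => t ⟨j.1, hsub j.1 j.2⟩)
  have i3 : condEnt μ (X a) (fun ω => (X b ω, tupleOf X S ω)) ≤ condEnt μ (X a) (X b) :=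
    condEnt_le μ hμ (X a) (fun ω => (X b ω, tupleOf X S ω)) Prod.fst
  have i4 := hci S haS hbS
  have i5 : ent μ (fun ω => (X b ω, (X a ω, tupleOf X S ω)))
      = ent μ (fun ω => (X a ω, (X b ω, tupleOf X S ω))) := by
    apply ent_congr
    intro ω ω'
    simp only [Prod.mk.injEq]
    tauto
  simp only [famEnt] at hm i1 i2 hla
  have c1 : condEnt μ (X b) (fun ω => (X a ω, tupleOf X S ω)) + condEnt μ (X a) (tupleOf X S)
      = condEnt μ (X a) (fun ω => (X b ω, tupleOf X S ω)) + condEnt μ (X b) (tupleOf X S) := by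
    simp only [condEnt]; linarith
  linarith
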